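/- arXiv:1811.06269 — 4 statements merged into one kernel-verified Lean document; each statement's English description precedes it below -/
import Mathlib

section
/- Let G be a connected finite simple graph on n vertices with m edges and connected domination number γ_c(G) = k, and let D_c be a minimum connected dominating set of G. Then the c-dominating energy satisfies E_{D_c}(G) ≤ √(n(2m + k)). -/
open Finset Matrix

set_option linter.unusedSectionVars false

variable {V : Type*} [Fintype V] [DecidableEq V]

/-- `D` is a dominating set of `G`: every vertex is in `D` or adjacent to a vertex of `D`. -/
def IsDominatingSet (G : SimpleGraph V) (D : Finset V) : Prop :=
  ∀ v : V, v ∈ D ∨ ∃ u ∈ D, G.Adj u v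

/-- `D` is a connected dominating set: a dominating set inducing a connected subgraph. -/
def IsConnectedDominatingSet (G : SimpleGraph V) (D : Finset V) : Prop :=
  IsDominatingSet G D ∧ (G.induce (D : Set V)).Connected

/-- `D` is a minimum dominating set of `G`. -/
def IsMinimumDominatingSet (G : SimpleGraph V) (D : Finset V) : Prop :=
  IsDominatingSet G D ∧ ∀ D' : Finset V, IsDominatingSet G D' → D.card ≤ D'.card

/-- `D` is a minimum connected dominating set of `G`. -/
def IsMinimumConnectedDominatingSet (G : SimpleGraph V) (D : Finset V) : Prop :=
  IsConnectedDominatingSet G D ∧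
    ∀ D' : Finset V, IsConnectedDominatingSet G D' → D.card ≤ D'.card

/-- The (minimum/connected) dominating matrix of `G` w.r.t. a set `D`:
entry `(i,j)` is `1` if `i` is adjacent to `j`, `1` if `i = j ∈ D`, and `0` otherwise. -/
def domMatrix (G : SimpleGraph V) [DecidableRel G.Adj] (D : Finset V) : Matrix V V ℝ :=
  Matrix.of fun i j =>
    if i = j then (if i ∈ D then 1 else 0) else (if G.Adj i j then 1 else 0)

theorem domMatrix_isHermitian (G : SimpleGraph V) [DecidableRel G.Adj] (D : Finset V) :
    (domMatrix G D).IsHermitian := by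
  show (domMatrix G D)ᴴ = domMatrix G D
  ext i j
  simp only [Matrix.conjTranspose_apply, domMatrix, Matrix.of_apply, star_trivial]
  rcases eq_or_ne i j with rfl | h
  · simp
  · rw [if_neg (Ne.symm h), if_neg h]
    simp only [G.adj_comm j i]

/-- The eigenvalues of the dominating matrix (real, since the matrix is symmetric). -/
noncomputable def domEigen (G : SimpleGraph V) [DecidableRel G.Adj] (D : Finset V) : V → ℝ :=
  (domMatrix_isHermitian G D).eigenvalues

/-- The (c-)dominating energy: the sum of the absolute values of the eigenvalues
of the dominating matrix. -/
noncomputable def domEnergy (G : SimpleGraph V) [DecidableRel G.Adj] (D : Finset V) : ℝ :=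
  ∑ i, |domEigen G D i|

/-- A support vertex: a vertex adjacent to a pendant vertex (a vertex of degree 1). -/
def IsSupportVertex (G : SimpleGraph V) [DecidableRel G.Adj] (v : V) : Prop :=
  ∃ u, G.Adj v u ∧ G.degree u = 1

/-- The trace of the square of a real symmetric matrix is the sum of the squared eigenvalues. -/
theorem sum_sq_eigenvalues_eq_trace {A : Matrix V V ℝ} (hA : A.IsHermitian) :
    ∑ i, hA.eigenvalues i ^ 2 = (A * A).trace := by
  conv_rhs => rw [hA.spectral_theorem]
  rw [← map_mul, Unitary.conjStarAlgAut_apply, Matrix.trace_mul_cycle, Unitary.coe_star_mul_self,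
    one_mul, Matrix.diagonal_mul_diagonal, Matrix.trace_diagonal]
  simp [sq]

/-- Products of transposed entries of the dominating matrix split into a diagonal and an
adjacency part. -/
theorem domMatrix_apply_mul_apply_swap (G : SimpleGraph V) [DecidableRel G.Adj] (D : Finset V)
    (i j : V) :
    domMatrix G D i j * domMatrix G D j i =
      (if i = j then (if i ∈ D then 1 else 0) else 0) + (if G.Adj i j then 1 else 0) := by
  rcases eq_or_ne i j with rfl | h
  · simp [domMatrix]
  · simp [domMatrix, h, h.symm, G.adj_comm j i]

theorem trace_domMatrix_mul_self (G : SimpleGraph V) [DecidableRel G.Adj] (D : Finset V) :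
    (domMatrix G D * domMatrix G D).trace = 2 * (#G.edgeFinset : ℝ) + (#D : ℝ) := by
  have hdeg : ∑ i, (G.degree i : ℝ) = 2 * (#G.edgeFinset : ℝ) := by
    exact_mod_cast G.sum_degrees_eq_twice_card_edges
  simp only [Matrix.trace, Matrix.diag_apply, Matrix.mul_apply, domMatrix_apply_mul_apply_swap,
    Finset.sum_add_distrib]
  rw [add_comm, ← hdeg]
  congr 1
  · refine Finset.sum_congr rfl fun i _ => ?_
    rw [Finset.sum_boole, ← G.card_neighborFinset_eq_degree, G.neighborFinset_eq_filter]
  · simp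

/-- McClelland-type upper bound: for a connected graph `G` on `n` vertices with `m` edges
and connected domination number `k`, the c-dominating energy satisfies
`E_{D_c}(G) ≤ √(n(2m + k))`. -/
theorem cDomEnergy_le_sqrt (n m k : ℕ) (G : SimpleGraph (Fin n)) [DecidableRel G.Adj]
    (hconn : G.Connected) (hm : G.edgeFinset.card = m)
    (Dc : Finset (Fin n)) (hDc : IsMinimumConnectedDominatingSet G Dc) (hk : Dc.card = k) :
    domEnergy G Dc ≤ Real.sqrt ((n : ℝ) * (2 * (m : ℝ) + (k : ℝ))) := by
  refine Real.le_sqrt_of_sq_le ?_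
  have hsq : ∑ i, |domEigen G Dc i| ^ 2 = 2 * (m : ℝ) + (k : ℝ) := by
    simp only [sq_abs]
    rw [← hm, ← hk, ← trace_domMatrix_mul_self G Dc]
    exact sum_sq_eigenvalues_eq_trace (domMatrix_isHermitian G Dc)
  have hcs := sq_sum_le_card_mul_sum_sq (s := Finset.univ) (f := fun i => |domEigen G Dc i|)
  rwa [hsq, Finset.card_univ, Fintype.card_fin] at hcs
end

section
/- Let G be a connected finite simple graph on n ≥ 1 vertices with m edges, let D_c be a minimum connected dominating set of G with |D_c| = γ_c(G), and let λ_1 be the largest eigenvalue of the c-dominating matrix A_{D_c}(G). Then λ_1 ≥ (2m + γ_c(G)) / n. -/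
open Finset Matrix

set_option linter.unusedSectionVars false

variable {V : Type*} [Fintype V] [DecidableEq V]

/-- The quadratic form of a real symmetric matrix is bounded by any upper bound of its
eigenvalues times the squared norm. -/
theorem Matrix.IsHermitian.dotProduct_mulVec_le_of_eigenvalues_le {A : Matrix V V ℝ}
    (hA : A.IsHermitian) {c : ℝ} (hc : ∀ i, hA.eigenvalues i ≤ c) (x : V → ℝ) :
    x ⬝ᵥ A *ᵥ x ≤ c * (x ⬝ᵥ x) := by
  have hdiag : (diagonal fun i => c - hA.eigenvalues i).PosSemidef :=
    PosSemidef.diagonal fun i => sub_nonneg.2 (hc i)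
  have hpsd := hdiag.mul_mul_conjTranspose_same (hA.eigenvectorUnitary : Matrix V V ℝ)
  have hU : (hA.eigenvectorUnitary : Matrix V V ℝ) *
      (hA.eigenvectorUnitary : Matrix V V ℝ)ᴴ = 1 :=
    Unitary.coe_mul_star_self hA.eigenvectorUnitary
  have hspec : A = (hA.eigenvectorUnitary : Matrix V V ℝ) * diagonal hA.eigenvalues *
      (hA.eigenvectorUnitary : Matrix V V ℝ)ᴴ := by
    simpa [Unitary.conjStarAlgAut_apply, star_eq_conjTranspose, Function.comp_def]
      using hA.spectral_theorem
  have hsplit : (hA.eigenvectorUnitary : Matrix V V ℝ) *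
      (diagonal fun i => c - hA.eigenvalues i) *
      (hA.eigenvectorUnitary : Matrix V V ℝ)ᴴ = c • 1 - A := by
    rw [← diagonal_sub, ← smul_one_eq_diagonal, mul_sub, sub_mul, ← hspec, mul_smul_comm,
      smul_mul_assoc, mul_one, hU]
  rw [hsplit] at hpsd
  have hnonneg := hpsd.dotProduct_mulVec_nonneg x
  simpa [sub_mulVec, smul_mulVec, dotProduct_sub] using hnonneg

/-- The entries of the dominating matrix sum to `2m + |D|`. -/
theorem sum_sum_domMatrix (G : SimpleGraph V) [DecidableRel G.Adj] (D : Finset V) :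
    ∑ i, ∑ j, domMatrix G D i j = 2 * (#G.edgeFinset : ℝ) + (#D : ℝ) := by
  have hentry (i j : V) : domMatrix G D i j =
      (if G.Adj i j then 1 else 0) + if i = j then (if i ∈ D then 1 else 0) else 0 := by
    rcases eq_or_ne i j with rfl | h <;> simp [domMatrix, *]
  have hrow (i : V) : ∑ j, domMatrix G D i j = (G.degree i : ℝ) + if i ∈ D then 1 else 0 := by
    simp [hentry, Finset.sum_add_distrib, ← G.card_neighborFinset_eq_degree,
      G.neighborFinset_eq_filter]
  simp_rw [hrow, Finset.sum_add_distrib]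
  have hdeg : ∑ i, (G.degree i : ℝ) = 2 * (#G.edgeFinset : ℝ) := by
    exact_mod_cast G.sum_degrees_eq_twice_card_edges
  simp [hdeg]

/-- The largest eigenvalue `λ₁` of the c-dominating matrix satisfies
`λ₁ ≥ (2m + γ_c(G)) / n`. -/
theorem cDom_largest_eigenvalue_ge (n m : ℕ) (hn : 0 < n)
    (G : SimpleGraph (Fin n)) [DecidableRel G.Adj]
    (hconn : G.Connected) (hm : G.edgeFinset.card = m)
    (Dc : Finset (Fin n)) (hDc : IsMinimumConnectedDominatingSet G Dc)
    (lam1 : ℝ) (hmem : ∃ i, domEigen G Dc i = lam1)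
    (hmax : ∀ i, domEigen G Dc i ≤ lam1) :
    (2 * (m : ℝ) + (Dc.card : ℝ)) / (n : ℝ) ≤ lam1 := by
  have hquad := (domMatrix_isHermitian G Dc).dotProduct_mulVec_le_of_eigenvalues_le hmax 1
  rw [div_le_iff₀ (by exact_mod_cast hn), ← hm, ← sum_sum_domMatrix]
  simpa [dotProduct, mulVec] using hquad
end

section
/- Let G be a connected finite simple graph on n vertices with m edges and connected domination number γ_c(G), and let D_c be a minimum connected dominating set of G. If 2m + γ_c(G) ≥ n, then E_{D_c}(G) ≤ (2m + γ_c(G))/n + √((n−1)[(2m + γ_c(G)) − ((2m + γ_c(G))/n)²]). -/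
open Finset Matrix

set_option linter.unusedSectionVars false

variable {V : Type*} [Fintype V] [DecidableEq V]

namespace Matrix.IsHermitian

/-- The squares of the eigenvalues of a real symmetric matrix sum to the trace of its square. -/
theorem sum_eigenvalues_sq {ι : Type*} [Fintype ι] [DecidableEq ι] {A : Matrix ι ι ℝ}
    (hA : A.IsHermitian) : ∑ i, hA.eigenvalues i ^ 2 = (A * A).trace := by
  conv_rhs => rw [hA.spectral_theorem, ← map_mul, Unitary.conjStarAlgAut_apply,
    Matrix.trace_mul_comm, ← mul_assoc]
  simp [Matrix.trace_diagonal, sq]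

/-- If the quadratic form of a real symmetric matrix is at least `c * ‖x‖²` at some `x ≠ 0`,
then some eigenvalue is at least `c`. -/
theorem exists_le_eigenvalues {ι : Type*} [Fintype ι] [DecidableEq ι] {A : Matrix ι ι ℝ}
    (hA : A.IsHermitian) {c : ℝ} {x : ι → ℝ} (hx : x ≠ 0)
    (h : c * (x ⬝ᵥ x) ≤ x ⬝ᵥ A *ᵥ x) : ∃ i, c ≤ hA.eigenvalues i := by
  set U : Matrix ι ι ℝ := (hA.eigenvectorUnitary : Matrix ι ι ℝ)
  set y : ι → ℝ := star U *ᵥ x with hy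
  have hUU : U * star U = 1 := Unitary.coe_mul_star_self hA.eigenvectorUnitary
  have hvec : x ᵥ* U = y := by
    rw [hy, Matrix.star_eq_conjTranspose, Matrix.conjTranspose_eq_transpose_of_trivial,
      Matrix.mulVec_transpose]
  have hyy : y ⬝ᵥ y = x ⬝ᵥ x := by
    nth_rw 1 [← hvec]
    rw [← Matrix.dotProduct_mulVec, hy, Matrix.mulVec_mulVec, hUU, Matrix.one_mulVec]
  have hquad : x ⬝ᵥ A *ᵥ x = ∑ i, hA.eigenvalues i * (y i * y i) := by
    have hspec : A = U * (diagonal hA.eigenvalues * star U) := by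
      conv_lhs => rw [hA.spectral_theorem, Unitary.conjStarAlgAut_apply, mul_assoc]
      rfl
    conv_lhs => rw [hspec, ← Matrix.mulVec_mulVec, Matrix.dotProduct_mulVec, hvec,
      ← Matrix.mulVec_mulVec, ← hy]
    simp only [dotProduct, Matrix.mulVec_diagonal]
    exact Finset.sum_congr rfl fun i _ => by ring
  by_contra! hlt
  have hy0 : ∃ i, y i ≠ 0 := by
    by_contra! h0
    apply hx
    rw [← dotProduct_self_eq_zero, ← hyy]
    simp [dotProduct, h0]
  obtain ⟨j, hj⟩ := hy0
  have : ∑ i, hA.eigenvalues i * (y i * y i) < ∑ i, c * (y i * y i) :=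
    Finset.sum_lt_sum (fun i _ => mul_le_mul_of_nonneg_right (hlt i).le (mul_self_nonneg _))
      ⟨j, Finset.mem_univ j, mul_lt_mul_of_pos_right (hlt j) (mul_self_pos.mpr hj)⟩
  rw [← hquad, ← Finset.mul_sum] at this
  rw [← hyy] at h
  exact absurd h (not_le.mpr this)

end Matrix.IsHermitian

section DomMatrix

variable (G : SimpleGraph V) [DecidableRel G.Adj] (D : Finset V)

theorem sum_domMatrix :
    ∑ i, ∑ j, domMatrix G D i j = 2 * (G.edgeFinset.card : ℝ) + D.card := by
  have hentry : ∀ i j, domMatrix G D i j =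
      (if G.Adj i j then 1 else 0) + (if i = j then (if i ∈ D then 1 else 0) else 0) := by
    intro i j
    rcases eq_or_ne i j with rfl | h <;> simp [domMatrix, *]
  have hdeg : ∀ i, ∑ j, (if G.Adj i j then (1 : ℝ) else 0) = G.degree i := by
    intro i
    rw [Finset.sum_boole, ← G.card_neighborFinset_eq_degree, G.neighborFinset_eq_filter]
  simp only [hentry, Finset.sum_add_distrib, hdeg]
  congr 1
  · exact_mod_cast G.sum_degrees_eq_twice_card_edges
  · simp

theorem trace_domMatrix_mul_self_s9 :
    (domMatrix G D * domMatrix G D).trace = ∑ i, ∑ j, domMatrix G D i j := by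
  simp only [Matrix.trace, Matrix.diag, Matrix.mul_apply]
  refine Finset.sum_congr rfl fun i _ => Finset.sum_congr rfl fun j _ => ?_
  rw [show domMatrix G D j i = domMatrix G D i j from (domMatrix_isHermitian G D).apply i j]
  simp only [domMatrix, Matrix.of_apply]
  split_ifs <;> simp

end DomMatrix

/-- The optimization step in the Koolen–Moulton bound: the map
`a ↦ a + √((n - 1) * (n * μ - a ^ 2))` is bounded for `a ≥ μ ≥ 1` by its value at `μ`. -/
theorem add_le_add_sqrt_of_sq_le {n : ℕ} (hn : 1 ≤ n) {μ a t : ℝ} (hμ : 1 ≤ μ) (ha : μ ≤ a)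
    (hSa : a ^ 2 ≤ n * μ) (ht : t ^ 2 ≤ (n - 1) * (n * μ - a ^ 2)) :
    a + t ≤ μ + √((n - 1) * (n * μ - μ ^ 2)) := by
  suffices h : t + (a - μ) ≤ √((n - 1) * (n * μ - μ ^ 2)) by linarith
  apply Real.le_sqrt_of_sq_le
  obtain rfl | hn2 := hn.eq_or_lt
  · have ht0 : t = 0 := by simpa [sq_nonpos_iff] using ht
    have : a = μ := by push_cast at hSa; nlinarith
    simp [ht0, this]
  · have hn2 : (2 : ℝ) ≤ n := by exact_mod_cast hn2
    have hgap : n * μ - a ^ 2 ≤ (n - 1) * μ ^ 2 := by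
      have hμsq : n * μ ≤ n * μ ^ 2 :=
        mul_le_mul_of_nonneg_left (by nlinarith) (Nat.cast_nonneg n)
      nlinarith
    have ht_le : t ≤ (n - 1) * μ := by
      refine le_of_sq_le_sq ?_ (mul_nonneg (by linarith) (by linarith))
      calc t ^ 2 ≤ (n - 1) * (n * μ - a ^ 2) := ht
        _ ≤ (n - 1) * ((n - 1) * μ ^ 2) := mul_le_mul_of_nonneg_left hgap (by linarith)
        _ = ((n - 1) * μ) ^ 2 := by ring
    have hcross : t * (a - μ) ≤ (n - 1) * μ * (a - μ) :=
      mul_le_mul_of_nonneg_right ht_le (by linarith)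
    have hsq : (a - μ) ^ 2 ≤ (n - 1) * (a - μ) ^ 2 :=
      le_mul_of_one_le_left (sq_nonneg _) (by linarith)
    linarith

/-- Cauchy–Schwarz with one term split off. -/
theorem sum_abs_erase_sq_le {ι : Type*} [Fintype ι] [DecidableEq ι] (f : ι → ℝ) (k : ι) :
    (∑ i ∈ univ.erase k, |f i|) ^ 2 ≤ (Fintype.card ι - 1) * (∑ i, f i ^ 2 - f k ^ 2) := by
  have h := sq_sum_le_card_mul_sum_sq (s := univ.erase k) (f := fun i => |f i|)
  rw [Finset.cast_card_erase_of_mem (Finset.mem_univ k), Finset.card_univ] at h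
  simpa only [sq_abs, Finset.sum_erase_eq_sub (Finset.mem_univ k)] using h

/-- Koolen–Moulton-type upper bound: if `2m + γ_c(G) ≥ n` then
`E_{D_c}(G) ≤ (2m+γ_c(G))/n + √((n−1)[(2m+γ_c(G)) − ((2m+γ_c(G))/n)²])`. -/
theorem cDomEnergy_le_koolen_moulton (n m : ℕ)
    (G : SimpleGraph (Fin n)) [DecidableRel G.Adj]
    (hconn : G.Connected) (hm : G.edgeFinset.card = m)
    (Dc : Finset (Fin n)) (hDc : IsMinimumConnectedDominatingSet G Dc)
    (hbig : (n : ℝ) ≤ 2 * (m : ℝ) + (Dc.card : ℝ)) :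
    domEnergy G Dc ≤ (2 * (m : ℝ) + (Dc.card : ℝ)) / (n : ℝ) +
      Real.sqrt (((n : ℝ) - 1) *
        ((2 * (m : ℝ) + (Dc.card : ℝ)) - ((2 * (m : ℝ) + (Dc.card : ℝ)) / (n : ℝ)) ^ 2)) := by
  subst hm
  have : Nonempty (Fin n) := hconn.nonempty
  have hn : 1 ≤ n := Fin.pos_iff_nonempty.mpr this
  have hn0 : (0 : ℝ) < n := by exact_mod_cast hn
  set S : ℝ := 2 * (G.edgeFinset.card : ℝ) + (Dc.card : ℝ)
  have hsum : ∑ i, ∑ j, domMatrix G Dc i j = S := sum_domMatrix G Dc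
  have hsq : ∑ i, domEigen G Dc i ^ 2 = S :=
    ((domMatrix_isHermitian G Dc).sum_eigenvalues_sq.trans
      (trace_domMatrix_mul_self_s9 G Dc)).trans hsum
  have hSn : n * (S / n) = S := mul_div_cancel₀ S hn0.ne'
  obtain ⟨k, hk⟩ : ∃ k, S / n ≤ domEigen G Dc k := by
    refine (domMatrix_isHermitian G Dc).exists_le_eigenvalues (x := 1) one_ne_zero ?_
    simp [dotProduct, Matrix.mulVec, hsum, hn0.ne']
  have hμ : 1 ≤ S / n := (one_le_div hn0).mpr hbig
  have hka : domEigen G Dc k ^ 2 ≤ n * (S / n) := by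
    rw [hSn, ← hsq]
    exact Finset.single_le_sum (f := fun i => domEigen G Dc i ^ 2)
      (fun i _ => sq_nonneg _) (Finset.mem_univ k)
  have hrest := sum_abs_erase_sq_le (domEigen G Dc) k
  rw [Fintype.card_fin, hsq] at hrest
  have hmain := add_le_add_sqrt_of_sq_le hn hμ hk hka (by rwa [hSn])
  rw [hSn] at hmain
  rwa [domEnergy, ← Finset.add_sum_erase _ _ (Finset.mem_univ k),
    abs_of_nonneg (zero_le_one.trans (hμ.trans hk))]
end

section
/- Let K_n be the complete graph on n ≥ 2 vertices. Then the c-dominating energy of K_n is E_{D_c}(K_n) = (n − 2) + √(n(n−2) + 5). -/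
open Finset Matrix

set_option linter.unusedSectionVars false

variable {V : Type*} [Fintype V] [DecidableEq V]

theorem Matrix.IsHermitian.trace_mul_self_eq_sum_eigenvalues_sq {A : Matrix V V ℝ}
    (hA : A.IsHermitian) : (A * A).trace = ∑ i, hA.eigenvalues i ^ 2 := by
  conv_lhs => rw [hA.spectral_theorem]
  rw [← map_mul, Unitary.conjStarAlgAut_apply, Matrix.trace_mul_cycle,
    Unitary.coe_star_mul_self, one_mul, Matrix.diagonal_mul_diagonal, Matrix.trace_diagonal]
  simp [pow_two]

/-- In a complete graph, a minimum connected dominating set is a single vertex. -/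
theorem IsMinimumConnectedDominatingSet.exists_eq_singleton {D : Finset V}
    (hD : IsMinimumConnectedDominatingSet (⊤ : SimpleGraph V) D) : ∃ d, D = {d} := by
  obtain ⟨⟨-, hconn⟩, hmin⟩ := hD
  obtain ⟨d, hd⟩ := hconn.nonempty
  have hd' : d ∈ D := by simpa using hd
  have hle : D.card ≤ 1 := by
    refine (hmin {d} ⟨fun v => ?_, ?_⟩).trans_eq (card_singleton d)
    · rcases eq_or_ne v d with h | h
      · simp [h]
      · exact Or.inr ⟨d, by simp, by simpa using h.symm⟩
    · rw [coe_singleton]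
      exact SimpleGraph.connected_iff _ |>.2
        ⟨SimpleGraph.Preconnected.of_subsingleton, ⟨⟨d, rfl⟩⟩⟩
  exact ⟨d, eq_singleton_iff_unique_mem.2
    ⟨hd', fun x hx => card_le_one.1 hle x hx d hd'⟩⟩

theorem domMatrix_top_singleton_apply [DecidableRel (⊤ : SimpleGraph V).Adj] (d i j : V) :
    domMatrix (⊤ : SimpleGraph V) {d} i j =
      1 - (if i = j then 1 else 0) + (if i = j then (if i = d then 1 else 0) else 0) := by
  by_cases h : i = j <;> simp [domMatrix, h]

theorem trace_domMatrix_top_singleton [DecidableRel (⊤ : SimpleGraph V).Adj] (d : V) :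
    (domMatrix (⊤ : SimpleGraph V) {d}).trace = 1 := by
  simp [Matrix.trace, domMatrix_top_singleton_apply]

theorem trace_domMatrix_top_singleton_mul_self [DecidableRel (⊤ : SimpleGraph V).Adj] (d : V) :
    (domMatrix (⊤ : SimpleGraph V) {d} * domMatrix (⊤ : SimpleGraph V) {d}).trace =
      (Fintype.card V : ℝ) ^ 2 - Fintype.card V + 1 := by
  have key (i j : V) : domMatrix (⊤ : SimpleGraph V) {d} i j * domMatrix (⊤ : SimpleGraph V) {d} j i
      = 1 - (if i = j then 1 else 0) + (if i = j then (if i = d then 1 else 0) else 0) := by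
    by_cases h : i = j
    · subst h
      simp [domMatrix]
    · simp [domMatrix, h, Ne.symm h]
  simp only [Matrix.trace, Matrix.diag_apply, Matrix.mul_apply, key, sum_add_distrib,
    sum_sub_distrib, sum_const, card_univ, nsmul_eq_mul, sum_ite_eq, mem_univ, if_true, mul_one,
    sum_ite_eq']
  ring

/-- The eigenvalues of the dominating matrix of `K_n` for a single vertex are `-1` and the roots of
`x ^ 2 - (n - 1) * x - 1`. -/
theorem eigenvalue_domMatrix_top_singleton [DecidableRel (⊤ : SimpleGraph V).Adj] (d : V) {x : ℝ}
    {v : V → ℝ} (hv : v ≠ 0) (h : domMatrix (⊤ : SimpleGraph V) {d} *ᵥ v = x • v) :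
    x = -1 ∨ x ^ 2 - ((Fintype.card V : ℝ) - 1) * x - 1 = 0 := by
  have hrow (i : V) : (x + 1) * v i = ∑ j, v j + if i = d then v d else 0 := by
    have hi := congrFun h i
    simp only [Matrix.mulVec, dotProduct, domMatrix_top_singleton_apply, add_mul, sub_mul, one_mul,
      ite_mul, zero_mul, sum_add_distrib, sum_sub_distrib, sum_ite_eq, mem_univ, if_true,
      Pi.smul_apply, smul_eq_mul] at hi
    rcases eq_or_ne i d with rfl | hid
    · simp only [if_true] at hi ⊢
      linarith
    · simp only [hid, if_false] at hi ⊢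
      linarith
  rw [or_iff_not_imp_left]
  intro hx
  have hx1 : x + 1 ≠ 0 := fun h0 => hx (by linarith)
  have hsum : (x + 1) * ∑ j, v j = Fintype.card V * ∑ j, v j + v d := by
    rw [mul_sum, sum_congr rfl fun i _ => hrow i]
    simp [sum_add_distrib]
  have hd : ∑ j, v j = x * v d := by
    have := hrow d
    simp only [if_true] at this
    linarith
  have hvd : v d ≠ 0 := by
    intro h0
    refine hv (funext fun i => ?_)
    have := hrow i
    simpa [hd, h0, hx1] using this
  rw [hd] at hsum
  refine mul_right_cancel₀ hvd ?_
  linear_combination hsum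

/-- For the complete graph `K_n` with `n ≥ 2`, the c-dominating energy is
`E_{D_c}(K_n) = (n − 2) + √(n(n−2) + 5)`. -/
theorem cDomEnergy_completeGraph (n : ℕ) (hn : 2 ≤ n)
    (G : SimpleGraph (Fin n)) [DecidableRel G.Adj] (hG : G = ⊤)
    (Dc : Finset (Fin n)) (hDc : IsMinimumConnectedDominatingSet G Dc) :
    domEnergy G Dc = ((n : ℝ) - 2) + Real.sqrt ((n : ℝ) * ((n : ℝ) - 2) + 5) := by
  subst hG
  obtain ⟨d, rfl⟩ := hDc.exists_eq_singleton
  have hA := domMatrix_isHermitian (⊤ : SimpleGraph (Fin n)) {d}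
  have htrace : ∑ i, domEigen ⊤ {d} i = 1 := by
    rw [← trace_domMatrix_top_singleton d, hA.trace_eq_sum_eigenvalues]
    rfl
  have htrace2 : ∑ i, domEigen ⊤ {d} i ^ 2 = (n : ℝ) ^ 2 - n + 1 := by
    have := hA.trace_mul_self_eq_sum_eigenvalues_sq
    rw [trace_domMatrix_top_singleton_mul_self, Fintype.card_fin] at this
    exact this.symm
  have heig (i : Fin n) : domEigen ⊤ {d} i = -1 ∨
      domEigen ⊤ {d} i ^ 2 - ((n : ℝ) - 1) * domEigen ⊤ {d} i - 1 = 0 := by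
    have := eigenvalue_domMatrix_top_singleton d
      (fun h0 => hA.eigenvectorBasis.orthonormal.ne_zero i (WithLp.ofLp_injective 2 h0))
      (hA.mulVec_eigenvectorBasis i)
    rwa [Fintype.card_fin] at this
  have hn' : (2 : ℝ) ≤ n := by exact_mod_cast hn
  set s := Real.sqrt ((n : ℝ) * ((n : ℝ) - 2) + 5) with hs
  have hs2 : s ^ 2 = (n : ℝ) * ((n : ℝ) - 2) + 5 := Real.sq_sqrt (by nlinarith)
  have hs_gt : (n : ℝ) - 1 < s := Real.lt_sqrt_of_sq_lt (by nlinarith)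
  -- `a` and `b` are the roots of `x ^ 2 - (n - 1) * x - 1`
  obtain ⟨a, ha⟩ : ∃ a, a = ((n : ℝ) - 1 + s) / 2 := ⟨_, rfl⟩
  obtain ⟨b, hb⟩ : ∃ b, b = ((n : ℝ) - 1 - s) / 2 := ⟨_, rfl⟩
  have hab : a + b = n - 1 := by rw [ha, hb]; ring
  have hmul : a * b = -1 := by rw [ha, hb]; linear_combination (-1 / 4) * hs2
  have ha0 : 0 < a := by rw [ha]; linarith
  have hb0 : b < 0 := by rw [hb]; linarith
  have hc : (a + 1) * (a - b) ≠ 0 := mul_ne_zero (by linarith) (by linarith)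
  -- on the spectrum, the absolute value agrees with a quadratic polynomial
  have habs (i : Fin n) : (a + 1) * (a - b) * |domEigen ⊤ {d} i| =
      2 * a * (domEigen ⊤ {d} i ^ 2 + (1 - b) * domEigen ⊤ {d} i - b) -
        (a + 1) * (a - b) * domEigen ⊤ {d} i := by
    have hroots : domEigen ⊤ {d} i = -1 ∨ domEigen ⊤ {d} i = a ∨ domEigen ⊤ {d} i = b := by
      refine (heig i).imp_right fun h => ?_
      have : (domEigen ⊤ {d} i - a) * (domEigen ⊤ {d} i - b) = 0 := by
        linear_combination h - domEigen ⊤ {d} i * hab + hmul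
      exact (mul_eq_zero.1 this).imp sub_eq_zero.1 sub_eq_zero.1
    rcases hroots with h | h | h <;> rw [h]
    · rw [abs_neg, abs_one]; ring
    · rw [abs_of_pos ha0]; ring
    · rw [abs_of_neg hb0]; ring
  refine mul_left_cancel₀ hc ?_
  rw [domEnergy, mul_sum, sum_congr rfl fun i _ => habs i, sum_sub_distrib, ← mul_sum, ← mul_sum,
    sum_sub_distrib, sum_add_distrib, ← mul_sum, htrace, htrace2]
  simp only [sum_const, card_univ, Fintype.card_fin, nsmul_eq_mul]
  have hsa : s = 2 * a - (n - 1) := by rw [ha]; ring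
  have hna : (n : ℝ) = a + b + 1 := by linarith
  rw [hsa, hna]
  linear_combination 4 * a * hmul
end
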